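/- The elliptic curve Y² = X³ − X² − 4X + 4 over ℚ has Mordell–Weil group of order 8 (it is finite with exactly 8 rational points including the point at infinity). -/

import Mathlib

/-- If a product of two integers is a nonzero square, both are a common divisor times a square,
up to a common sign. -/
theorem factor_sq (A B y : ℤ) (hA : A ≠ 0) (h : A * B = y ^ 2) :
    ∃ g s a b : ℤ, 0 < g ∧ g ∣ A ∧ g ∣ B ∧ (s = 1 ∨ s = -1) ∧ A = s * g * a ^ 2 ∧
      B = s * g * b ^ 2 := by
  have hg : 0 < Int.gcd A B := Int.gcd_pos_of_ne_zero_left _ hA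
  obtain ⟨A', B', hc, hA', hB'⟩ := Int.exists_gcd_one hg
  set g : ℤ := (Int.gcd A B : ℤ) with hgdef
  have hg' : (0 : ℤ) < g := by rw [hgdef]; exact_mod_cast hg
  have h1 : g ^ 2 ∣ y ^ 2 := ⟨A' * B', by rw [← h, hA', hB']; ring⟩
  have h2 : g ∣ y := (Int.pow_dvd_pow_iff (by norm_num)).1 h1
  obtain ⟨z, rfl⟩ := h2
  have h3 : A' * B' = z ^ 2 := by
    have : g ^ 2 * (A' * B') = g ^ 2 * z ^ 2 := by rw [hA', hB'] at h; linear_combination h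
    exact mul_left_cancel₀ (by positivity) this
  have hA0 : A' ≠ 0 := by rintro rfl; simp at hA'; exact hA hA'
  obtain ⟨a, ha⟩ := Int.sq_of_gcd_eq_one hc h3
  obtain ⟨b, hb⟩ := Int.sq_of_gcd_eq_one (by rw [Int.gcd_comm]; exact hc) (by rw [mul_comm]; exact h3)
  have hAB : 0 ≤ A' * B' := by rw [h3]; positivity
  have ha0 : a ≠ 0 := by rintro rfl; simp at ha; exact hA0 ha
  have ha2 : 0 < a ^ 2 := by positivity
  have hdA : g ∣ A := ⟨A', by rw [hA']; ring⟩
  have hdB : g ∣ B := ⟨B', by rw [hB']; ring⟩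
  rcases ha with ha | ha <;> rcases hb with hb | hb
  · exact ⟨g, 1, a, b, hg', hdA, hdB, Or.inl rfl, by rw [hA', ha]; ring, by rw [hB', hb]; ring⟩
  · have : b ^ 2 = 0 := by
      rw [ha, hb] at hAB
      nlinarith [sq_nonneg b]
    exact ⟨g, 1, a, b, hg', hdA, hdB, Or.inl rfl, by rw [hA', ha]; ring,
      by rw [hB', hb, this]; ring⟩
  · have : b ^ 2 = 0 := by
      rw [ha, hb] at hAB
      nlinarith [sq_nonneg b]
    exact ⟨g, -1, a, b, hg', hdA, hdB, Or.inr rfl, by rw [hA', ha]; ring,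
      by rw [hB', hb, this]; ring⟩
  · exact ⟨g, -1, a, b, hg', hdA, hdB, Or.inr rfl, by rw [hA', ha]; ring, by rw [hB', hb]; ring⟩

theorem three_dvd_of_sq_add (a b : ℤ) (h : (3 : ℤ) ∣ a ^ 2 + b ^ 2) : (3 : ℤ) ∣ a ∧ (3 : ℤ) ∣ b := by
  have ha : a % 3 = 0 ∨ a % 3 = 1 ∨ a % 3 = 2 := by omega
  have hb : b % 3 = 0 ∨ b % 3 = 1 ∨ b % 3 = 2 := by omega
  have h' := Int.emod_eq_zero_of_dvd h
  rcases ha with ha | ha | ha <;> rcases hb with hb | hb | hb <;>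
    (simp [Int.add_emod, pow_two, Int.mul_emod, ha, hb] at h'; try omega)

theorem core (α β γ δ : ℤ) (h1 : IsCoprime α δ) (h2 : IsCoprime β γ) (hα : α ≠ 0) 
    (hγ : γ ≠ 0)
    (h : α ^ 2 * (4 * γ ^ 2 - β ^ 2) = δ ^ 2 * (β ^ 2 - γ ^ 2)) :
    δ ^ 2 + α ^ 2 = γ ^ 2 ∧ δ ^ 2 + 4 * α ^ 2 = β ^ 2 := by
  have hc : IsCoprime (α ^ 2) (δ ^ 2) := h1.pow
  have hd : α ^ 2 ∣ β ^ 2 - γ ^ 2 := hc.dvd_of_dvd_mul_left ⟨_, h.symm⟩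
  obtain ⟨k, hk⟩ := hd
  have hα2 : α ^ 2 ≠ 0 := by positivity
  have hk2 : 4 * γ ^ 2 - β ^ 2 = k * δ ^ 2 := by
    apply mul_left_cancel₀ hα2
    rw [h, hk]; ring
  have e1 : 3 * γ ^ 2 = k * (α ^ 2 + δ ^ 2) := by linear_combination hk + hk2
  have e2 : 3 * β ^ 2 = k * (4 * α ^ 2 + δ ^ 2) := by linear_combination 4 * hk + hk2
  have hk3 : k ∣ 3 := by
    obtain ⟨u, v, huv⟩ : IsCoprime (β ^ 2) (γ ^ 2) := h2.pow
    exact ⟨u * (4 * α ^ 2 + δ ^ 2) + v * (α ^ 2 + δ ^ 2), by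
      linear_combination (-3) * huv + u * e2 + v * e1⟩
  have hkpos : 0 < k := by
    have : 0 < k * (α ^ 2 + δ ^ 2) := by rw [← e1]; positivity
    exact pos_of_mul_pos_left this (by positivity)
  have hkle := Int.le_of_dvd (by norm_num) hk3
  interval_cases k
  · exfalso
    obtain ⟨a, b⟩ := three_dvd_of_sq_add α δ ⟨γ ^ 2, by linarith⟩
    have := h1.isUnit_of_dvd' a b
    rw [Int.isUnit_iff] at this; omega
  · norm_num at hk3
  · constructor <;> linarith

theorem descent : ∀ N : ℕ, ∀ p q z w : ℤ, (p * q).natAbs = N → IsCoprime p q → p ≠ 0 → q ≠ 0 →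
    p ^ 2 + q ^ 2 = z ^ 2 → p ^ 2 + 4 * q ^ 2 = w ^ 2 → False := by
  intro N
  induction N using Nat.strong_induction_on with
  | _ N ih =>
  intro p q z w hN hc hp hq hz hw
  rcases Int.even_or_odd p with hev | hodd
  · obtain ⟨v, hv⟩ := hev
    obtain rfl : p = 2 * v := by omega
    have hwe : Even w := by
      have : Even (w ^ 2) := ⟨2 * v ^ 2 + 2 * q ^ 2, by rw [← hw]; ring⟩
      exact (Int.even_pow.1 this).1
    obtain ⟨w', hw'⟩ := hwe
    obtain rfl : w = 2 * w' := by omega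
    have hv0 : v ≠ 0 := by rintro rfl; simp at hp
    refine ih (q * v).natAbs ?_ q v w' z rfl hc.symm.of_mul_right_right hq hv0 (by linarith) (by linarith)
    rw [← hN]
    have : 0 < (q * v).natAbs := Int.natAbs_pos.2 (mul_ne_zero hq hv0)
    rw [show 2 * v * q = 2 * (q * v) by ring, Int.natAbs_mul 2]
    change _ < 2 * _
    omega
  · have hz0 : z ≠ 0 := by rintro rfl; have : 0 < p ^ 2 := by positivity
                           nlinarith [sq_nonneg q]
    have hw0 : w ≠ 0 := by rintro rfl; have : 0 < p ^ 2 := by positivity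
                           nlinarith [sq_nonneg q]
    have hp2 : p % 2 = 1 := Int.odd_iff.1 hodd
    have hp2c : IsCoprime p 2 := by
      rw [Int.isCoprime_iff_gcd_eq_one]
      have := Int.odd_iff.1 hodd
      rw [Int.isCoprime_iff_gcd_eq_one.symm]
      exact ⟨1, -(p / 2), by omega⟩
    have t1 : PythagoreanTriple p q |z| := by
      unfold PythagoreanTriple; rw [abs_mul_abs_self]; linarith
    have t2 : PythagoreanTriple p (2 * q) |w| := by
      unfold PythagoreanTriple; rw [abs_mul_abs_self]; linarith
    obtain ⟨m, n, hpm, hqm, -, hmn, -, -⟩ := t1.coprime_classification'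
      (Int.isCoprime_iff_gcd_eq_one.1 hc) hp2 (abs_pos.2 hz0)
    obtain ⟨r, s, hpr, hqr, -, hrs, hpar, -⟩ := t2.coprime_classification'
      (Int.isCoprime_iff_gcd_eq_one.1 (hp2c.mul_right hc)) hp2 (abs_pos.2 hw0)
    have hmnc : IsCoprime m n := Int.isCoprime_iff_gcd_eq_one.2 hmn
    have hmn0 : m * n ≠ 0 := by
      intro h0; apply hq; rw [hqm]; linarith
    have fin : ∀ P Q u v : ℤ, P * Q ∣ m * n → IsCoprime P Q → P ≠ 0 → Q ≠ 0 →
        P ^ 2 + Q ^ 2 = u ^ 2 ∧ P ^ 2 + 4 * Q ^ 2 = v ^ 2 → False := by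
      intro P Q u v hdvd hco hP hQ h3
      refine ih (P * Q).natAbs ?_ P Q u v rfl hco hP hQ h3.1 h3.2
      have hle := Nat.le_of_dvd (Int.natAbs_pos.2 hmn0) (Int.natAbs_dvd_natAbs.2 hdvd)
      have h0 := Int.natAbs_pos.2 hmn0
      have hp0 := Int.natAbs_pos.2 hp
      have hN' : N = p.natAbs * (2 * (m * n).natAbs) := by
        rw [← hN, hqm, show p * (2 * m * n) = p * (2 * (m * n)) by ring, Int.natAbs_mul p,
          Int.natAbs_mul 2]
        rfl
      rw [hN']
      nlinarith
    have hEq : r ^ 2 - s ^ 2 = m ^ 2 - n ^ 2 := by rw [← hpr, ← hpm]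
    have hRS : r * s = 2 * (m * n) := by linarith
    have key : ∀ x y : ℤ, x * y = m * n → ∃ α β γ δ : ℤ, x = α * γ ∧ y = β * δ ∧ 
        m = α * β ∧ n = γ * δ := by
      intro x y hxy
      have : x ∣ m * n := ⟨y, hxy.symm⟩
      obtain ⟨α, γ, ⟨β, hβ⟩, ⟨δ, hδ⟩, hx⟩ := exists_dvd_and_dvd_of_dvd_mul this
      refine ⟨α, β, γ, δ, hx, ?_, hβ, hδ⟩
      have hx0 : x ≠ 0 := by rintro rfl; simp at hxy; simp [hxy] at hmn0
      apply mul_left_cancel₀ hx0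
      rw [hxy, hβ, hδ, hx]; ring
    have nz : ∀ α β γ δ : ℤ, m = α * β → n = γ * δ → IsCoprime α δ ∧ IsCoprime β γ ∧ α ≠ 0 ∧ 
        γ ≠ 0 ∧ β ≠ 0 ∧ δ ≠ 0 := by
      intro α β γ δ h1 h2
      rw [h1, h2] at hmnc hmn0
      refine ⟨hmnc.of_mul_left_left.of_mul_right_right, hmnc.of_mul_left_right.of_mul_right_left,
        ?_, ?_, ?_, ?_⟩ <;> rintro rfl <;> simp at hmn0
    rcases hpar with ⟨hr, -⟩ | ⟨-, hs⟩
    · obtain ⟨r', rfl⟩ : (2 : ℤ) ∣ r := Int.dvd_of_emod_eq_zero hr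
      obtain ⟨α, β, γ, δ, hx, hy, hm, hn⟩ := key r' s (by linarith)
      obtain ⟨c1, c2, a0, g0, b0, d0⟩ := nz α β γ δ hm hn
      refine fin δ α γ β ⟨β * γ, by rw [hm, hn]; ring⟩ c1.symm d0 a0
        (core α β γ δ c1 c2 a0 g0 ?_)
      rw [hx, hy, hm, hn] at hEq
      linear_combination hEq
    · obtain ⟨s', rfl⟩ : (2 : ℤ) ∣ s := Int.dvd_of_emod_eq_zero hs
      obtain ⟨α, β, γ, δ, hx, hy, hm, hn⟩ := key r s' (by linarith)
      obtain ⟨c1, c2, a0, g0, b0, d0⟩ := nz α β γ δ hm hn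
      refine fin α δ β γ ⟨β * γ, by rw [hm, hn]; ring⟩ c1 a0 d0
        (core δ γ β α c1.symm c2.symm d0 b0 ?_)
      rw [hx, hy, hm, hn] at hEq
      linear_combination -hEq

theorem concordant_one (t : ℚ) (ht : t ≠ 0) (h1 : IsSquare (t ^ 2 + 1))
    (h4 : IsSquare (t ^ 2 + 4)) : False := by
  have hd : (t.den : ℚ) ≠ 0 := by exact_mod_cast t.den_ne_zero
  have hnum : (t.num : ℚ) = t * t.den := (Rat.mul_den_eq_num t).symm
  have e1 : IsSquare (t.num ^ 2 + (t.den : ℤ) ^ 2) := by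
    rw [← Rat.isSquare_intCast_iff]
    obtain ⟨r, hr⟩ := h1
    refine ⟨r * t.den, ?_⟩
    push_cast
    rw [hnum]
    linear_combination (t.den : ℚ) ^ 2 * hr
  have e4 : IsSquare (t.num ^ 2 + 4 * (t.den : ℤ) ^ 2) := by
    rw [← Rat.isSquare_intCast_iff]
    obtain ⟨r, hr⟩ := h4
    refine ⟨r * t.den, ?_⟩
    push_cast
    rw [hnum]
    linear_combination (t.den : ℚ) ^ 2 * hr
  obtain ⟨z, hz⟩ := e1
  obtain ⟨w, hw⟩ := e4
  exact descent _ t.num t.den z w rfl (Rat.isCoprime_num_den t) (Rat.num_ne_zero.2 ht)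
    (by exact_mod_cast t.den_ne_zero) (by rw [hz]; ring) (by rw [hw]; ring)

/-- Euler: `p² + q²` and `p² + 4 q²` are both squares only in trivial cases. -/
theorem concordant (p q z w : ℚ) (h1 : p ^ 2 + q ^ 2 = z ^ 2) (h4 : p ^ 2 + 4 * q ^ 2 = w ^ 2) :
    p = 0 ∨ q = 0 := by
  by_contra! h
  obtain ⟨hp, hq⟩ := h
  refine concordant_one (p / q) (div_ne_zero hp hq) ⟨z / q, ?_⟩ ⟨w / q, ?_⟩
  · field_simp; linarith
  · field_simp; linarith

theorem not_three (e n : ℤ) (hc : IsCoprime n e) (h1 : (3 : ℤ) ∣ e) (h2 : (3 : ℤ) ∣ n) :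
    False := by
  have := hc.isUnit_of_dvd' h2 h1
  rw [Int.isUnit_iff] at this; omega

theorem int_cases (n e Y : ℤ) (hc : IsCoprime n e) (he : e ≠ 0) (hY : Y ≠ 0)
    (h : (n - e ^ 2) * ((n - 2 * e ^ 2) * (n + 2 * e ^ 2)) = Y ^ 2) :
    ∃ a c w : ℤ,
      (n - e ^ 2 = a ^ 2 ∧ n - 2 * e ^ 2 = c ^ 2 ∧ n + 2 * e ^ 2 = w ^ 2) ∨
      (n - e ^ 2 = -3 * a ^ 2 ∧ n - 2 * e ^ 2 = -c ^ 2 ∧ n + 2 * e ^ 2 = 3 * w ^ 2) ∨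
      (n - e ^ 2 = -a ^ 2 ∧ n - 2 * e ^ 2 = -2 * c ^ 2 ∧ n + 2 * e ^ 2 = 2 * w ^ 2) ∨
      (n - e ^ 2 = 3 * a ^ 2 ∧ n - 2 * e ^ 2 = 2 * c ^ 2 ∧ n + 2 * e ^ 2 = 6 * w ^ 2) := by
  have hY2 : 0 < Y ^ 2 := by positivity
  have he2 : 0 < e ^ 2 := by positivity
  have hA0 : n - e ^ 2 ≠ 0 := by intro h0; rw [h0] at h; linarith
  have hC0 : n - 2 * e ^ 2 ≠ 0 := by intro h0; rw [h0] at h; linarith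
  have hD0 : n + 2 * e ^ 2 ≠ 0 := by intro h0; rw [h0] at h; linarith
  have hDpos : 0 < n + 2 * e ^ 2 := by
    by_contra hneg
    have hneg : n + 2 * e ^ 2 < 0 := lt_of_le_of_ne (not_lt.1 hneg) hD0
    have hp : 0 < (n - e ^ 2) * (n - 2 * e ^ 2) :=
      mul_pos_of_neg_of_neg (by linarith) (by linarith)
    have := mul_neg_of_pos_of_neg hp hneg
    linarith
  obtain ⟨g, s, a, b, hg, hgA, hgB, hs, hA, hB⟩ := factor_sq _ _ _ hA0 h
  have hg3 : g = 1 ∨ g = 3 := by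
    have hcop : IsCoprime g (e ^ 4) := by
      have h1 : IsCoprime (n - e ^ 2) e := by
        have := hc.add_mul_right_left (-e)
        rwa [show n + -e * e = n - e ^ 2 by ring] at this
      exact (h1.of_isCoprime_of_dvd_left hgA).pow_right
    have h3 : g ∣ 3 * e ^ 4 := by
      have := dvd_sub (hgA.mul_right (n + e ^ 2)) hgB
      rwa [show (n - e ^ 2) * (n + e ^ 2) - (n - 2 * e ^ 2) * (n + 2 * e ^ 2) = 3 * e ^ 4 by ring]
        at this
    have h3' : g ∣ 3 := hcop.dvd_of_dvd_mul_right h3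
    have := Int.le_of_dvd (by norm_num) h3'
    clear hA hB hgA hgB hcop h3
    interval_cases g
    · simp
    · norm_num at h3'
    · simp
  have hss : s * s = 1 := by rcases hs with rfl | rfl <;> norm_num
  -- split off `g` from the third factor
  obtain ⟨D, hD⟩ : g ∣ n + 2 * e ^ 2 := by
    rcases hg3 with rfl | rfl
    · exact one_dvd _
    · have := dvd_add hgA (Dvd.intro (e ^ 2) rfl : (3 : ℤ) ∣ 3 * e ^ 2)
      rwa [show n - e ^ 2 + 3 * e ^ 2 = n + 2 * e ^ 2 by ring] at this
  have hCD : (s * (n - 2 * e ^ 2)) * D = b ^ 2 := by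
    apply mul_left_cancel₀ hg.ne'
    rw [hD] at hB
    linear_combination s * hB + g * b ^ 2 * hss
  have hDp : 0 < D := by rw [hD] at hDpos; exact pos_of_mul_pos_right hDpos hg.le
  have hs0 : s ≠ 0 := by rintro rfl; simp at hss
  obtain ⟨k, t, c, w, hk, hkC, hkD, ht, hC, hDw⟩ := factor_sq _ _ _ (mul_ne_zero hs0 hC0) hCD
  have ht1 : t = 1 := by
    rcases ht with rfl | rfl
    · rfl
    · exfalso
      have : 0 ≤ k * w ^ 2 := by positivity
      linarith
  subst ht1
  have hC' : n - 2 * e ^ 2 = s * k * c ^ 2 := by linear_combination s * hC - (n - 2 * e ^ 2) * hss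
  have hkC' : k ∣ n - 2 * e ^ 2 := ⟨s * c ^ 2, by rw [hC']; ring⟩
  have hk4 : k = 1 ∨ k = 2 ∨ k = 4 := by
    have hcop : IsCoprime k (e ^ 2) := by
      have h1 : IsCoprime (n - 2 * e ^ 2) e := by
        have := hc.add_mul_right_left (-2 * e)
        rwa [show n + -2 * e * e = n - 2 * e ^ 2 by ring] at this
      exact (h1.of_isCoprime_of_dvd_left hkC').pow_right
    have h3 : k ∣ 4 * e ^ 2 := by
      have hkD' : k ∣ n + 2 * e ^ 2 := by rw [hD]; exact hkD.mul_left g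
      have := dvd_sub hkD' hkC'
      rwa [show (n + 2 * e ^ 2) - (n - 2 * e ^ 2) = 4 * e ^ 2 by ring] at this
    have h3' : k ∣ 4 := hcop.dvd_of_dvd_mul_right h3
    have := Int.le_of_dvd (by norm_num) h3'
    clear hC hC' hkC hkD hkC' hDw hcop h3
    interval_cases k
    · simp
    · simp
    · norm_num at h3'
    · simp
  rw [hDw] at hD
  obtain ⟨k', c', w', hk', hC'', hD'⟩ : ∃ k' c' w' : ℤ, (k' = 1 ∨ k' = 2) ∧
      n - 2 * e ^ 2 = s * k' * c' ^ 2 ∧ n + 2 * e ^ 2 = g * k' * w' ^ 2 := by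
    rcases hk4 with rfl | rfl | rfl
    · exact ⟨1, c, w, Or.inl rfl, hC', by rw [hD]; ring⟩
    · exact ⟨2, c, w, Or.inr rfl, hC', by rw [hD]; ring⟩
    · exact ⟨1, 2 * c, 2 * w, Or.inl rfl, by rw [hC']; ring, by rw [hD]; ring⟩
  clear hC hC' hk4 hkC hkC' hkD hCD hDw hD hB hgA hgB h
  refine ⟨a, c', w', ?_⟩
  rcases hg3 with rfl | rfl <;> rcases hs with rfl | rfl <;> rcases hk' with rfl | rfl
  · left; refine ⟨?_, ?_, ?_⟩ <;> linarith
  · exfalso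
    -- `3e² = 2w² - a²`
    obtain ⟨⟨x, hx⟩, ⟨z, hz⟩⟩ := three_dvd_of_sq_add a w' ⟨w' ^ 2 - e ^ 2, by linarith⟩
    subst hx hz
    have h1 : (3 : ℤ) ∣ e := Int.prime_three.dvd_of_dvd_pow (n := 2)
      ⟨2 * z ^ 2 - x ^ 2, by linarith⟩
    exact not_three e n hc h1 (by rw [show n = e ^ 2 + (3 * x) ^ 2 by linarith]
                                  exact dvd_add (dvd_pow h1 (by norm_num)) ⟨3 * x ^ 2, by ring⟩)
  · exfalso
    -- `3e² = w² + a²`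
    obtain ⟨⟨x, hx⟩, ⟨z, hz⟩⟩ := three_dvd_of_sq_add a w' ⟨e ^ 2, by linarith⟩
    subst hx hz
    have h1 : (3 : ℤ) ∣ e := Int.prime_three.dvd_of_dvd_pow (n := 2)
      ⟨z ^ 2 + x ^ 2, by linarith⟩
    exact not_three e n hc h1 (by rw [show n = e ^ 2 + -(3 * x) ^ 2 by linarith]
                                  exact dvd_add (dvd_pow h1 (by norm_num)) ⟨-3 * x ^ 2, by ring⟩)
  · right; right; left; refine ⟨?_, ?_, ?_⟩ <;> linarith
  · exfalso
    -- `e² = 3a² - c²`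
    obtain ⟨h1, -⟩ := three_dvd_of_sq_add e c' ⟨a ^ 2, by linarith⟩
    exact not_three e n hc h1 (by rw [show n = e ^ 2 + 1 * 3 * a ^ 2 by linarith]
                                  exact dvd_add (dvd_pow h1 (by norm_num)) ⟨a ^ 2, by ring⟩)
  · right; right; right; refine ⟨?_, ?_, ?_⟩ <;> linarith
  · right; left; refine ⟨?_, ?_, ?_⟩ <;> linarith
  · exfalso
    -- `e² = 2c² - 3a²`
    obtain ⟨h1, -⟩ := three_dvd_of_sq_add e c' ⟨c' ^ 2 - a ^ 2, by linarith⟩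
    exact not_three e n hc h1 (by rw [show n = e ^ 2 + -1 * 3 * a ^ 2 by linarith]
                                  exact dvd_add (dvd_pow h1 (by norm_num)) ⟨-a ^ 2, by ring⟩)

theorem rat_cases (x y : ℚ) (hy : y ≠ 0) (h : y ^ 2 = (x - 1) * (x - 2) * (x + 2)) :
    ∃ a c w : ℚ,
      (x - 1 = a ^ 2 ∧ x - 2 = c ^ 2 ∧ x + 2 = w ^ 2) ∨
      (x - 1 = -3 * a ^ 2 ∧ x - 2 = -c ^ 2 ∧ x + 2 = 3 * w ^ 2) ∨
      (x - 1 = -a ^ 2 ∧ x - 2 = -2 * c ^ 2 ∧ x + 2 = 2 * w ^ 2) ∨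
      (x - 1 = 3 * a ^ 2 ∧ x - 2 = 2 * c ^ 2 ∧ x + 2 = 6 * w ^ 2) := by
  obtain ⟨n, d, hdp, hco, hnum⟩ : ∃ n d : ℤ, 0 < d ∧ IsCoprime n d ∧ (n : ℚ) = x * d :=
    ⟨x.num, x.den, by exact_mod_cast x.den_pos, Rat.isCoprime_num_den x,
      by simpa using (Rat.mul_den_eq_num x).symm⟩
  have hsq : IsSquare (d * ((n - d) * ((n - 2 * d) * (n + 2 * d)))) := by
    rw [← Rat.isSquare_intCast_iff]
    refine ⟨y * d ^ 2, ?_⟩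
    push_cast
    rw [hnum]
    linear_combination -(d : ℚ) ^ 4 * h
  obtain ⟨Y, hY⟩ := hsq
  have key : ∀ k : ℤ, IsCoprime d (n + k * d) := fun k => (hco.add_mul_right_left k).symm
  have c1 := key (-1)
  have c2 := key (-2)
  have c3 := key 2
  rw [show n + -1 * d = n - d by ring] at c1
  rw [show n + -2 * d = n - 2 * d by ring] at c2
  have c := c1.mul_right (c2.mul_right c3)
  obtain ⟨e, he⟩ := Int.sq_of_isCoprime c (by rw [hY, sq])
  have he : d = e ^ 2 := by
    rcases he with he | he
    · exact he
    · nlinarith [sq_nonneg e]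
  have he0 : e ≠ 0 := by rintro rfl; simp at he; omega
  subst he
  have hdY : e ∣ Y := by
    apply (Int.pow_dvd_pow_iff (n := 2) (by norm_num)).1
    exact ⟨_, by rw [sq Y, ← hY]⟩
  obtain ⟨Z, rfl⟩ := hdY
  have hZ : (n - e ^ 2) * ((n - 2 * e ^ 2) * (n + 2 * e ^ 2)) = Z ^ 2 := by
    apply mul_left_cancel₀ (pow_ne_zero 2 he0)
    rw [hY]; ring
  have heq : (e : ℚ) ≠ 0 := by exact_mod_cast he0
  push_cast at hnum
  have hZ0 : Z ≠ 0 := by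
    rintro rfl
    have hq : ((n : ℚ) - e ^ 2) * ((n - 2 * e ^ 2) * (n + 2 * e ^ 2)) = 0 ^ 2 := by
      exact_mod_cast hZ
    rw [hnum] at hq
    have : (y ^ 2) * (e : ℚ) ^ 6 = 0 := by rw [h]; linear_combination hq
    exact (mul_ne_zero (pow_ne_zero 2 hy) (pow_ne_zero 6 heq)) this
  have hx : x = n / (e : ℚ) ^ 2 := by rw [hnum]; field_simp
  have hne : IsCoprime n e := (IsCoprime.pow_right_iff (by norm_num)).1 hco
  obtain ⟨a, c, w, H⟩ := int_cases n e Z hne he0 hZ0 hZ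
  refine ⟨a / e, c / e, w / e, ?_⟩
  have conv : ∀ i j m : ℤ, n + i * e ^ 2 = j * m ^ 2 → x + i = j * ((m : ℚ) / e) ^ 2 := by
    intro i j m hm
    have hm' : (n : ℚ) + i * e ^ 2 = j * m ^ 2 := by exact_mod_cast hm
    rw [hx]; field_simp; linarith
  rcases H with ⟨h1, h2, h3⟩ | ⟨h1, h2, h3⟩ | ⟨h1, h2, h3⟩ | ⟨h1, h2, h3⟩
  · left
    have k1 := conv (-1) 1 a (by linarith)
    have k2 := conv (-2) 1 c (by linarith)
    have k3 := conv 2 1 w (by linarith)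
    push_cast at k1 k2 k3
    refine ⟨?_, ?_, ?_⟩ <;> linarith
  · right; left
    have k1 := conv (-1) (-3) a (by linarith)
    have k2 := conv (-2) (-1) c (by linarith)
    have k3 := conv 2 3 w (by linarith)
    push_cast at k1 k2 k3
    refine ⟨?_, ?_, ?_⟩ <;> linarith
  · right; right; left
    have k1 := conv (-1) (-1) a (by linarith)
    have k2 := conv (-2) (-2) c (by linarith)
    have k3 := conv 2 2 w (by linarith)
    push_cast at k1 k2 k3
    refine ⟨?_, ?_, ?_⟩ <;> linarith
  · right; right; right
    have k1 := conv (-1) 3 a (by linarith)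
    have k2 := conv (-2) 2 c (by linarith)
    have k3 := conv 2 6 w (by linarith)
    push_cast at k1 k2 k3
    refine ⟨?_, ?_, ?_⟩ <;> linarith

/-- A point in the trivial descent class has `x = 2`. -/
theorem trivial_class (x a c w : ℚ) (h1 : x - 1 = a ^ 2) (h2 : x - 2 = c ^ 2)
    (h3 : x + 2 = w ^ 2) : x = 2 := by
  rcases concordant c 1 a w (by linarith) (by linarith) with h | h
  · rw [h] at h2; linarith
  · norm_num at h

theorem points (x y : ℚ) (h : y ^ 2 = (x - 1) * (x - 2) * (x + 2)) :
    (x, y) ∈ ({(1, 0), (2, 0), (-2, 0), (0, 2), (0, -2), (4, 6), (4, -6)} : Finset (ℚ × ℚ)) := by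
  have hx : x = 1 ∨ x = 2 ∨ x = -2 ∨ x = 0 ∨ x = 4 := by
    by_cases hy : y = 0
    · rw [hy] at h
      have h' : (x - 1) * (x - 2) * (x + 2) = 0 := by rw [← h]; norm_num
      rcases mul_eq_zero.1 h' with h' | h'
      · rcases mul_eq_zero.1 h' with h' | h'
        · left; linarith
        · right; left; linarith
      · right; right; left; linarith
    obtain ⟨a, c, w, ⟨h1, h2, h3⟩ | ⟨h1, h2, h3⟩ | ⟨h1, h2, h3⟩ | ⟨h1, h2, h3⟩⟩ :=
      rat_cases x y hy h
    · right; left; exact trivial_class x a c w h1 h2 h3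
    · rcases concordant w a 1 c (by linarith) (by linarith) with h0 | h0
      · rw [h0] at h3; right; right; left; linarith
      · rw [h0] at h1; left; linarith
    · -- translate by `(0, 2)`
      by_contra! hne
      obtain ⟨n1, n2, n3, n0, n4⟩ := hne
      have ha : a ≠ 0 := by rintro rfl; apply n1; linarith
      have hc : c ≠ 0 := by rintro rfl; apply n2; linarith
      have hw : w ≠ 0 := by rintro rfl; apply n3; linarith
      obtain ⟨l, hl⟩ : ∃ l : ℚ, y = l * x + 2 := ⟨(y - 2) / x, by field_simp; ring⟩
      have hl2 : l ^ 2 * x + 4 * l = x ^ 2 - x - 4 := by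
        apply mul_left_cancel₀ n0
        rw [hl] at h
        linear_combination h
      have e2 : l ^ 2 + 1 - x - 2 = ((l + 1) / c) ^ 2 := by
        rw [div_pow, eq_div_iff (pow_ne_zero 2 hc)]
        linear_combination (l ^ 2 - 1 - x) / 2 * h2 - hl2 / 2
      have ht := trivial_class (l ^ 2 + 1 - x) ((l + 2) / a) ((l + 1) / c) ((1 - l) / w)
        (by rw [div_pow, eq_div_iff (pow_ne_zero 2 ha)]
            linear_combination (l ^ 2 - x) * h1 - hl2) e2
        (by rw [div_pow, eq_div_iff (pow_ne_zero 2 hw)]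
            linear_combination -(l ^ 2 + 3 - x) / 2 * h3 + hl2 / 2)
      rw [ht, sub_self] at e2
      have e3 : (l + 1) / c = 0 := pow_eq_zero_iff (two_ne_zero) |>.1 e2.symm
      have e4 : l + 1 = 0 := (div_eq_zero_iff.1 e3).resolve_right hc
      have e5 : l = -1 := by linarith
      rw [e5] at hl2
      have : x * (x - 2) = 0 := by linarith
      rcases mul_eq_zero.1 this with h0 | h0
      · exact n0 h0
      · exact n2 (by linarith)
    · -- translate by `(4, 6)`
      by_contra! hne
      obtain ⟨n1, n2, n3, n0, n4⟩ := hne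
      have ha : a ≠ 0 := by rintro rfl; apply n1; linarith
      have hc : c ≠ 0 := by rintro rfl; apply n2; linarith
      have hw : w ≠ 0 := by rintro rfl; apply n3; linarith
      have n4' : x - 4 ≠ 0 := sub_ne_zero.2 n4
      obtain ⟨l, hl⟩ : ∃ l : ℚ, y = l * (x - 4) + 6 := ⟨(y - 6) / (x - 4), by field_simp; ring⟩
      have hl2 : l ^ 2 * (x - 4) + 12 * l = x ^ 2 + 3 * x + 8 := by
        apply mul_left_cancel₀ n4'
        rw [hl] at h
        linear_combination h
      have e2 : l ^ 2 - 3 - x - 2 = ((3 - l) / c) ^ 2 := by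
        rw [div_pow, eq_div_iff (pow_ne_zero 2 hc)]
        linear_combination -(l ^ 2 - 5 - x) / 2 * h2 + hl2 / 2
      have ht := trivial_class (l ^ 2 - 3 - x) ((2 - l) / a) ((3 - l) / c) ((1 - l) / w)
        (by rw [div_pow, eq_div_iff (pow_ne_zero 2 ha)]
            linear_combination -(l ^ 2 - 4 - x) / 3 * h1 + hl2 / 3) e2
        (by rw [div_pow, eq_div_iff (pow_ne_zero 2 hw)]
            linear_combination -(l ^ 2 - 1 - x) / 6 * h3 + hl2 / 6)
      rw [ht, sub_self] at e2
      have e3 : (3 - l) / c = 0 := pow_eq_zero_iff (two_ne_zero) |>.1 e2.symm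
      have e4 : 3 - l = 0 := (div_eq_zero_iff.1 e3).resolve_right hc
      have e5 : l = 3 := by linarith
      rw [e5] at hl2
      have : (x - 4) * (x - 2) = 0 := by linarith
      rcases mul_eq_zero.1 this with h0 | h0
      · exact n4' h0
      · exact n2 (by linarith)
  rcases hx with rfl | rfl | rfl | rfl | rfl
  · have : y = 0 := by simpa using h
    simp [this]
  · have : y = 0 := by simpa using h
    simp [this]
  · have : y = 0 := by simpa using h
    simp [this]
  · have : (y - 2) * (y + 2) = 0 := by linarith
    rcases mul_eq_zero.1 this with h | h
    · have : y = 2 := by linarith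
      simp [this]
    · have : y = -2 := by linarith
      simp [this]
  · have : (y - 6) * (y + 6) = 0 := by linarith
    rcases mul_eq_zero.1 this with h | h
    · have : y = 6 := by linarith
      simp [this]
    · have : y = -6 := by linarith
      simp [this]

theorem nonsing (x y : ℚ) : WeierstrassCurve.Affine.Nonsingular
      ({ a₁ := 0, a₂ := -1, a₃ := 0, a₄ := -4, a₆ := 4 } : WeierstrassCurve.Affine ℚ) x y ↔
      (x, y) ∈ ({(1, 0), (2, 0), (-2, 0), (0, 2), (0, -2), (4, 6), (4, -6)} : Finset (ℚ × ℚ)) := by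
  rw [WeierstrassCurve.Affine.nonsingular_iff, WeierstrassCurve.Affine.equation_iff]
  constructor
  · rintro ⟨h, -⟩
    exact points x y (by simp only [] at h; linarith)
  · intro h
    simp only [Finset.mem_insert, Finset.mem_singleton, Prod.mk.injEq] at h
    rcases h with ⟨rfl, rfl⟩ | ⟨rfl, rfl⟩ | ⟨rfl, rfl⟩ | ⟨rfl, rfl⟩ | ⟨rfl, rfl⟩ | ⟨rfl, rfl⟩ |
      ⟨rfl, rfl⟩ <;> norm_num

/-- The elliptic curve `Y² = X³ − X² − 4X + 4` over `ℚ` has Mordell–Weil group of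
order 8: it has exactly 8 rational points, including the point at infinity. -/
theorem mordellWeil_card_24A1 :
    Nat.card (WeierstrassCurve.Affine.Point
      ({ a₁ := 0, a₂ := -1, a₃ := 0, a₄ := -4, a₆ := 4 } : WeierstrassCurve.Affine ℚ)) = 8 := by
  let S : Finset (ℚ × ℚ) := {(1, 0), (2, 0), (-2, 0), (0, 2), (0, -2), (4, 6), (4, -6)}
  let f : Option {p : ℚ × ℚ // p ∈ S} → WeierstrassCurve.Affine.Point
      ({ a₁ := 0, a₂ := -1, a₃ := 0, a₄ := -4, a₆ := 4 } : WeierstrassCurve.Affine ℚ) := fun o =>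
    match o with
    | none => .zero
    | some ⟨(x, y), h⟩ => .some x y ((nonsing x y).2 h)
  have hf : Function.Bijective f := by
    constructor
    · rintro (_ | ⟨⟨x, y⟩, h⟩) (_ | ⟨⟨x', y'⟩, h'⟩) hh
      · rfl
      · simp [f] at hh
      · simp [f] at hh
      · simp only [f, WeierstrassCurve.Affine.Point.some.injEq] at hh
        obtain ⟨rfl, rfl⟩ := hh
        rfl
    · rintro (_ | ⟨x, y, h⟩)
      · exact ⟨none, rfl⟩
      · exact ⟨some ⟨(x, y), (nonsing x y).1 h⟩, rfl⟩
  rw [← Nat.card_congr (Equiv.ofBijective f hf), Nat.card_eq_fintype_card, Fintype.card_option,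
    Fintype.card_coe]
  rfl
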